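/- Let K and ΔK be symmetric (m+n)×(m+n) real matrices, let ε ≥ 0, and let L̃ be an (m+n)×(m+n) lower triangular real matrix with positive diagonal entries such that K + ΔK = L̃·J_{m+n}·L̃ᵀ, |ΔK| ≤ ε·|L̃|·|L̃ᵀ| entrywise, and cond_F(L̃) · cond_F(L̃⁻ᵀ) · ε < 1/2. If ΔL is a matrix such that L̃ − ΔL is lower triangular with positive diagonal entries and K = (L̃ − ΔL)·J_{m+n}·(L̃ − ΔL)ᵀ, then ‖L̃⁻¹·ΔL‖_F ≤ (1 − √(1 − 2·cond_F(L̃)·cond_F(L̃⁻ᵀ)·ε))/√2. -/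

import Mathlib

open Matrix

noncomputable def frobNorm {k : ℕ} (A : Matrix (Fin k) (Fin k) ℝ) : ℝ :=
  Real.sqrt (∑ i, ∑ j, (A i j) ^ 2)

noncomputable def specNorm {k : ℕ} (A : Matrix (Fin k) (Fin k) ℝ) : ℝ :=
  ‖Matrix.toEuclideanCLM (𝕜 := ℝ) A‖

noncomputable def kappa2 {k : ℕ} (A : Matrix (Fin k) (Fin k) ℝ) : ℝ :=
  specNorm A⁻¹ * specNorm A

noncomputable def upTri {k : ℕ} (A : Matrix (Fin k) (Fin k) ℝ) : Matrix (Fin k) (Fin k) ℝ :=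
  Matrix.of fun i j => if i < j then A i j else if i = j then A i i / 2 else 0

noncomputable def Jmat (m n : ℕ) : Matrix (Fin (m + n)) (Fin (m + n)) ℝ :=
  Matrix.diagonal fun i => if (i : ℕ) < m then 1 else -1

def IsLowerTri {k : ℕ} (A : Matrix (Fin k) (Fin k) ℝ) : Prop :=
  ∀ i j, i < j → A i j = 0

def IsUpperTri {k : ℕ} (A : Matrix (Fin k) (Fin k) ℝ) : Prop :=
  ∀ i j, j < i → A i j = 0

def PosDiag {k : ℕ} (A : Matrix (Fin k) (Fin k) ℝ) : Prop :=
  ∀ i, 0 < A i i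

noncomputable def entAbs {k : ℕ} (A : Matrix (Fin k) (Fin k) ℝ) : Matrix (Fin k) (Fin k) ℝ :=
  Matrix.of fun i j => |A i j|

noncomputable def condF {k : ℕ} (A : Matrix (Fin k) (Fin k) ℝ) : ℝ :=
  frobNorm (entAbs A⁻¹ * entAbs A)

attribute [local instance] Matrix.frobeniusNormedAddCommGroup Matrix.frobeniusNormedSpace

lemma frobNorm_eq_norm {k : ℕ} (A : Matrix (Fin k) (Fin k) ℝ) : frobNorm A = ‖A‖ := by
  rw [Matrix.frobenius_norm_def, frobNorm, Real.sqrt_eq_rpow]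
  simp

lemma norm_sq_eq_sum {k : ℕ} (A : Matrix (Fin k) (Fin k) ℝ) :
    ‖A‖ ^ 2 = ∑ i, ∑ j, (A i j) ^ 2 := by
  rw [← frobNorm_eq_norm, frobNorm, Real.sq_sqrt (by positivity)]

lemma norm_le_of_abs_le {k : ℕ} {A B : Matrix (Fin k) (Fin k) ℝ}
    (h : ∀ i j, |A i j| ≤ B i j) : ‖A‖ ≤ ‖B‖ := by
  rw [← frobNorm_eq_norm, ← frobNorm_eq_norm]
  refine Real.sqrt_le_sqrt (Finset.sum_le_sum fun i _ => Finset.sum_le_sum fun j _ => ?_)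
  exact sq_le_sq.2 ((h i j).trans (le_abs_self _))

lemma abs_entry_le_norm {k : ℕ} (A : Matrix (Fin k) (Fin k) ℝ) (i j : Fin k) :
    |A i j| ≤ ‖A‖ := by
  refine abs_le_of_sq_le_sq ?_ (norm_nonneg _)
  rw [norm_sq_eq_sum]
  exact (Finset.single_le_sum (f := fun j => (A i j) ^ 2) (fun _ _ => sq_nonneg _)
    (Finset.mem_univ j)).trans
    (Finset.single_le_sum (f := fun i => ∑ j, (A i j) ^ 2)
      (fun _ _ => Finset.sum_nonneg fun _ _ => sq_nonneg _) (Finset.mem_univ i))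

lemma norm_mul_diagonal {k : ℕ} (A : Matrix (Fin k) (Fin k) ℝ) {d : Fin k → ℝ}
    (hd : ∀ i, d i * d i = 1) : ‖A * diagonal d‖ = ‖A‖ := by
  rw [← frobNorm_eq_norm, ← frobNorm_eq_norm, frobNorm, frobNorm]
  refine congrArg Real.sqrt (Finset.sum_congr rfl fun i _ => Finset.sum_congr rfl fun j _ => ?_)
  rw [mul_diagonal]
  linear_combination (A i j) ^ 2 * hd j

lemma norm_mul_diagonal_mul_transpose_le {k : ℕ} (A B : Matrix (Fin k) (Fin k) ℝ)
    {d : Fin k → ℝ} (hd : ∀ i, d i * d i = 1) : ‖A * diagonal d * Bᵀ‖ ≤ ‖A‖ * ‖B‖ := by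
  refine (Matrix.frobenius_norm_mul _ _).trans_eq ?_
  rw [norm_mul_diagonal A hd, Matrix.frobenius_norm_transpose]

lemma upTri_sub {k : ℕ} (A B : Matrix (Fin k) (Fin k) ℝ) :
    upTri (A - B) = upTri A - upTri B := by
  ext i j
  simp only [upTri, of_apply, Matrix.sub_apply]
  split_ifs <;> ring

lemma upTri_add_transpose {k : ℕ} {S : Matrix (Fin k) (Fin k) ℝ} (hS : Sᵀ = S) :
    upTri S + (upTri S)ᵀ = S := by
  ext i j
  have h : S j i = S i j := congrFun (congrFun hS i) j
  simp only [upTri, Matrix.add_apply, transpose_apply, of_apply]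
  rcases lt_trichotomy i j with hij | rfl | hij
  · simp [hij, hij.not_gt, hij.ne']
  · simp
  · simp [hij, hij.not_gt, hij.ne', h]

lemma norm_upTri_le {k : ℕ} {S : Matrix (Fin k) (Fin k) ℝ} (hS : Sᵀ = S) :
    ‖upTri S‖ ≤ ‖S‖ / √2 := by
  rw [le_div_iff₀ (by positivity)]
  refine abs_le_of_sq_le_sq' ?_ (norm_nonneg _) |>.2
  rw [mul_pow, Real.sq_sqrt zero_le_two, mul_two]
  nth_rw 1 [← Matrix.frobenius_norm_transpose]
  simp only [norm_sq_eq_sum, ← Finset.sum_add_distrib]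
  refine Finset.sum_le_sum fun i _ => Finset.sum_le_sum fun j _ => ?_
  have h : S j i = S i j := congrFun (congrFun hS i) j
  simp only [upTri, transpose_apply, of_apply]
  rcases lt_trichotomy i j with hij | rfl | hij
  · simp [hij, hij.not_gt, hij.ne']
  · simp; nlinarith [sq_nonneg (S i i)]
  · simp [hij, hij.not_gt, hij.ne', h]

lemma transpose_mul_diagonal_mul_transpose {k : ℕ} (X : Matrix (Fin k) (Fin k) ℝ)
    (d : Fin k → ℝ) : (X * diagonal d * Xᵀ)ᵀ = X * diagonal d * Xᵀ := by
  simp [transpose_mul, Matrix.mul_assoc]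

/-- The lower triangular solution of the perturbed equation, from the contraction principle. -/
lemma exists_small_triangular_solution {k : ℕ} {d : Fin k → ℝ} (hd : ∀ i, d i * d i = 1)
    {E : Matrix (Fin k) (Fin k) ℝ} (hE : Eᵀ = E) {c : ℝ} (hEc : ‖E‖ ≤ c) (hc : c < 1 / 2) :
    ∃ X : Matrix (Fin k) (Fin k) ℝ, IsLowerTri X ∧ ‖X‖ ≤ (1 - √(1 - 2 * c)) / √2 ∧
      (1 - X) * diagonal d * (1 - X)ᵀ = diagonal d - E := by
  set s := √(1 - 2 * c) with hs
  set r := (1 - s) / √2 with hr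
  have hc0 : 0 ≤ c := (norm_nonneg _).trans hEc
  have hs0 : 0 < s := Real.sqrt_pos.2 (by linarith)
  have hs2 : s ^ 2 = 1 - 2 * c := Real.sq_sqrt (by linarith)
  have hs1 : s ≤ 1 := by nlinarith
  have h2 : √2 ^ 2 = 2 := Real.sq_sqrt zero_le_two
  have h2p : 0 < √2 := by positivity
  have hrs : r * √2 = 1 - s := div_mul_cancel₀ _ h2p.ne'
  have hr0 : 0 ≤ r := div_nonneg (by linarith) h2p.le
  have hroot : c + r * r = r * √2 := by
    have : r ^ 2 * 2 = (1 - s) ^ 2 := by rw [← hrs, mul_pow, h2]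
    nlinarith
  let S : Matrix (Fin k) (Fin k) ℝ → Matrix (Fin k) (Fin k) ℝ :=
    fun X => E + X * diagonal d * Xᵀ
  let Φ : Matrix (Fin k) (Fin k) ℝ → Matrix (Fin k) (Fin k) ℝ :=
    fun X => (upTri (S X))ᵀ * diagonal d
  have hS : ∀ X, (S X)ᵀ = S X := fun X => by
    simp only [S, transpose_add, hE, transpose_mul_diagonal_mul_transpose]
  have hmaps : Set.MapsTo Φ (Metric.closedBall 0 r) (Metric.closedBall 0 r) := by
    intro X hX
    rw [mem_closedBall_zero_iff] at hX ⊢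
    simp only [Φ]
    rw [norm_mul_diagonal _ hd, Matrix.frobenius_norm_transpose]
    refine (norm_upTri_le (hS X)).trans ?_
    rw [div_le_iff₀ h2p, ← hroot]
    refine (norm_add_le _ _).trans (add_le_add hEc ?_)
    exact (norm_mul_diagonal_mul_transpose_le X X hd).trans
      (mul_le_mul hX hX (norm_nonneg _) hr0)
  have hlip : ∀ X ∈ Metric.closedBall (0 : Matrix (Fin k) (Fin k) ℝ) r,
      ∀ Y ∈ Metric.closedBall (0 : Matrix (Fin k) (Fin k) ℝ) r,
      dist (Φ X) (Φ Y) ≤ (1 - s) * dist X Y := by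
    intro X hX Y hY
    rw [mem_closedBall_zero_iff] at hX hY
    have hsub : S X - S Y = (X - Y) * diagonal d * Xᵀ + Y * diagonal d * (X - Y)ᵀ := by
      simp only [S, transpose_sub]
      noncomm_ring
    have hsym : (S X - S Y)ᵀ = S X - S Y := by rw [transpose_sub, hS, hS]
    rw [dist_eq_norm, dist_eq_norm]
    simp only [Φ]
    rw [← Matrix.sub_mul, ← transpose_sub, ← upTri_sub, norm_mul_diagonal _ hd,
      Matrix.frobenius_norm_transpose]
    refine (norm_upTri_le hsym).trans ?_
    rw [div_le_iff₀ h2p, hsub]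
    calc _ ≤ ‖X - Y‖ * ‖X‖ + ‖Y‖ * ‖X - Y‖ := (norm_add_le _ _).trans (add_le_add
            (norm_mul_diagonal_mul_transpose_le _ _ hd)
            (norm_mul_diagonal_mul_transpose_le _ _ hd))
      _ ≤ ‖X - Y‖ * r + r * ‖X - Y‖ := by gcongr
      _ = (1 - s) * ‖X - Y‖ * √2 := by
        rw [← hrs]; linear_combination (-r * ‖X - Y‖) * h2
  have hcontr : ContractingWith (Real.toNNReal (1 - s)) (hmaps.restrict Φ _ _) := by
    refine ⟨?_, LipschitzWith.of_dist_le_mul fun X Y => ?_⟩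
    · rw [Real.toNNReal_lt_one]
      linarith
    · rw [Real.coe_toNNReal _ (by linarith)]
      exact hlip X X.2 Y Y.2
  obtain ⟨X, hX, hfix, -⟩ := hcontr.exists_fixedPoint' Metric.isClosed_closedBall.isComplete
    hmaps (Metric.mem_closedBall_self hr0) (edist_ne_top _ _)
  have hfix : (upTri (S X))ᵀ * diagonal d = X := hfix
  have hdd : diagonal d * diagonal d = (1 : Matrix (Fin k) (Fin k) ℝ) := by
    simp [diagonal_mul_diagonal, hd]
  refine ⟨X, fun i j hij => ?_, mem_closedBall_zero_iff.1 hX, ?_⟩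
  · rw [← hfix, mul_diagonal]
    simp [upTri, hij.not_gt, hij.ne']
  · have hXd : X * diagonal d = (upTri (S X))ᵀ := by
      rw [← hfix, Matrix.mul_assoc, hdd, Matrix.mul_one, hfix]
    have hdX : diagonal d * Xᵀ = upTri (S X) := by
      rw [← transpose_transpose (upTri (S X)), ← hXd, transpose_mul, diagonal_transpose]
    have hsum : X * diagonal d + diagonal d * Xᵀ = E + X * diagonal d * Xᵀ := by
      change _ = S X
      rw [hXd, hdX, add_comm, upTri_add_transpose (hS X)]
    have hexp : (1 - X) * diagonal d * (1 - X)ᵀ =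
        diagonal d - (X * diagonal d + diagonal d * Xᵀ) + X * diagonal d * Xᵀ := by
      simp only [transpose_sub, transpose_one]
      noncomm_ring
    rw [hexp, hsum]
    abel

lemma isLowerTri_iff_blockTriangular {k : ℕ} {A : Matrix (Fin k) (Fin k) ℝ} :
    IsLowerTri A ↔ A.BlockTriangular OrderDual.toDual :=
  Iff.rfl

lemma IsLowerTri.isUnit_det {k : ℕ} {A : Matrix (Fin k) (Fin k) ℝ} (hA : IsLowerTri A)
    (hd : PosDiag A) : IsUnit A.det := by
  rw [det_of_isLowerTriangular A (isLowerTri_iff_blockTriangular.1 hA)]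
  exact (Finset.prod_pos fun i _ => hd i).ne'.isUnit

lemma IsLowerTri.inv {k : ℕ} {A : Matrix (Fin k) (Fin k) ℝ} (hA : IsLowerTri A)
    (hd : PosDiag A) : IsLowerTri A⁻¹ := by
  let := invertibleOfIsUnitDet A (hA.isUnit_det hd)
  exact blockTriangular_inv_of_blockTriangular (isLowerTri_iff_blockTriangular.1 hA)

lemma IsLowerTri.mul {k : ℕ} {A B : Matrix (Fin k) (Fin k) ℝ} (hA : IsLowerTri A)
    (hB : IsLowerTri B) : IsLowerTri (A * B) :=
  BlockTriangular.mul (isLowerTri_iff_blockTriangular.1 hA)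
    (isLowerTri_iff_blockTriangular.1 hB)

lemma IsLowerTri.mul_apply_self {k : ℕ} {A B : Matrix (Fin k) (Fin k) ℝ} (hA : IsLowerTri A)
    (hB : IsLowerTri B) (i : Fin k) : (A * B) i i = A i i * B i i := by
  rw [mul_apply]
  refine Finset.sum_eq_single i (fun j _ hj => ?_) (by simp)
  rcases hj.lt_or_gt with h | h
  · rw [hB j i h, mul_zero]
  · rw [hA i j h, zero_mul]

lemma IsLowerTri.posDiag_inv {k : ℕ} {A : Matrix (Fin k) (Fin k) ℝ} (hA : IsLowerTri A)
    (hd : PosDiag A) : PosDiag A⁻¹ := fun i => by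
  have h := (hA.inv hd).mul_apply_self hA i
  rw [nonsing_inv_mul A (hA.isUnit_det hd), one_apply_eq] at h
  exact pos_of_mul_pos_left (h ▸ one_pos) (hd i).le

lemma IsLowerTri.posDiag_mul {k : ℕ} {A B : Matrix (Fin k) (Fin k) ℝ} (hA : IsLowerTri A)
    (hB : IsLowerTri B) (hAd : PosDiag A) (hBd : PosDiag B) : PosDiag (A * B) := fun i => by
  rw [hA.mul_apply_self hB]
  exact mul_pos (hAd i) (hBd i)

lemma eq_one_of_mul_diagonal_mul_transpose {k : ℕ} {d : Fin k → ℝ}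
    (hd : ∀ i, d i * d i = 1) {M : Matrix (Fin k) (Fin k) ℝ} (hM : IsLowerTri M)
    (hMd : PosDiag M) (h : M * diagonal d * Mᵀ = diagonal d) : M = 1 := by
  have hu := hM.isUnit_det hMd
  have hMinv : diagonal d * Mᵀ = M⁻¹ * diagonal d := by
    nth_rw 2 [← h]
    rw [Matrix.mul_assoc, ← Matrix.mul_assoc M⁻¹, nonsing_inv_mul M hu, Matrix.one_mul]
  have hentry : ∀ i j, d i * M j i = M⁻¹ i j * d j := fun i j => by
    simpa [diagonal_mul, mul_diagonal] using congrFun (congrFun hMinv i) j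
  have hd0 : ∀ i, d i ≠ 0 := fun i hi => by simpa [hi] using hd i
  ext i j
  rcases lt_trichotomy i j with hij | rfl | hij
  · rw [hM i j hij, one_apply_ne hij.ne]
  · rw [one_apply_eq]
    have h1 : M i i = M⁻¹ i i := by
      have := hentry i i
      rw [mul_comm] at this
      exact mul_right_cancel₀ (hd0 i) this
    have h2 := hM.mul_apply_self (hM.inv hMd) i
    rw [mul_nonsing_inv M hu, one_apply_eq, ← h1] at h2
    nlinarith [hMd i]
  · rw [one_apply_ne hij.ne']
    have := hentry j i
    rw [hM.inv hMd j i hij, zero_mul] at this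
    exact (mul_eq_zero.1 this).resolve_left (hd0 j)

/-- Uniqueness of the generalized Cholesky factor. -/
lemma generalizedCholesky_unique {k : ℕ} {d : Fin k → ℝ} (hd : ∀ i, d i * d i = 1)
    {A B : Matrix (Fin k) (Fin k) ℝ} (hA : IsLowerTri A) (hAd : PosDiag A)
    (hB : IsLowerTri B) (hBd : PosDiag B)
    (h : A * diagonal d * Aᵀ = B * diagonal d * Bᵀ) : A = B := by
  have hu := hB.isUnit_det hBd
  have hBi := hB.inv hBd
  have hone : B⁻¹ * A = 1 := by
    refine eq_one_of_mul_diagonal_mul_transpose hd (hBi.mul hA)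
      (hBi.posDiag_mul hA (hB.posDiag_inv hBd) hAd) ?_
    calc B⁻¹ * A * diagonal d * (B⁻¹ * A)ᵀ = B⁻¹ * (A * diagonal d * Aᵀ) * B⁻¹ᵀ := by
          simp only [transpose_mul, Matrix.mul_assoc]
      _ = B⁻¹ * B * diagonal d * (B⁻¹ * B)ᵀ := by
          rw [h]; simp only [transpose_mul, Matrix.mul_assoc]
      _ = diagonal d := by simp [nonsing_inv_mul B hu]
  calc A = B * (B⁻¹ * A) := by rw [← Matrix.mul_assoc, mul_nonsing_inv B hu, Matrix.one_mul]
    _ = B := by rw [hone, Matrix.mul_one]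

lemma abs_mul_apply_le {k : ℕ} {A B A' B' : Matrix (Fin k) (Fin k) ℝ}
    (hA : ∀ i j, |A i j| ≤ A' i j) (hB : ∀ i j, |B i j| ≤ B' i j) (i j : Fin k) :
    |(A * B) i j| ≤ (A' * B') i j := by
  rw [mul_apply, mul_apply]
  refine (Finset.abs_sum_le_sum_abs _ _).trans (Finset.sum_le_sum fun l _ => ?_)
  rw [abs_mul]
  exact mul_le_mul (hA i l) (hB l j) (abs_nonneg _) ((abs_nonneg _).trans (hA i l))

lemma norm_scaled_perturbation_le {k : ℕ} {L D : Matrix (Fin k) (Fin k) ℝ} {ε : ℝ}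
    (hε : 0 ≤ ε) (hu : IsUnit L.det)
    (hD : ∀ i j, |D i j| ≤ ε * (entAbs L * entAbs Lᵀ) i j) :
    ‖L⁻¹ * D * L⁻¹ᵀ‖ ≤ condF L * condF L⁻¹ᵀ * ε := by
  have habs : ∀ (A : Matrix (Fin k) (Fin k) ℝ) i j, |A i j| ≤ entAbs A i j := fun _ _ _ => le_rfl
  have hinv : (L⁻¹ᵀ)⁻¹ = Lᵀ := by
    rw [← transpose_nonsing_inv, nonsing_inv_nonsing_inv L hu]
  have h := norm_le_of_abs_le (abs_mul_apply_le (abs_mul_apply_le (habs L⁻¹)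
    (B' := ε • (entAbs L * entAbs Lᵀ)) hD) (habs L⁻¹ᵀ))
  refine h.trans ?_
  have hre : entAbs L⁻¹ * (ε • (entAbs L * entAbs Lᵀ)) * entAbs L⁻¹ᵀ =
      ε • ((entAbs L⁻¹ * entAbs L) * (entAbs Lᵀ * entAbs L⁻¹ᵀ)) := by
    simp only [Matrix.mul_smul, Matrix.smul_mul, Matrix.mul_assoc]
  rw [hre, norm_smul, Real.norm_of_nonneg hε, condF, condF, hinv, frobNorm_eq_norm,
    frobNorm_eq_norm, mul_comm ε]
  exact mul_le_mul_of_nonneg_right (Matrix.frobenius_norm_mul _ _) hε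

theorem stmt18 (m n : ℕ) (K dK Lt dL : Matrix (Fin (m + n)) (Fin (m + n)) ℝ) (ε : ℝ)
    (hK : Kᵀ = K) (hdK : dKᵀ = dK) (hε : 0 ≤ ε)
    (hLt : IsLowerTri Lt) (hLtd : PosDiag Lt)
    (hfact : K + dK = Lt * Jmat m n * Ltᵀ)
    (hbound : ∀ i j, |dK i j| ≤ ε * (entAbs Lt * entAbs Ltᵀ) i j)
    (hsmall : condF Lt * condF (Lt⁻¹ᵀ) * ε < 1 / 2)
    (hL' : IsLowerTri (Lt - dL)) (hL'd : PosDiag (Lt - dL))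
    (hfact' : K = (Lt - dL) * Jmat m n * (Lt - dL)ᵀ) :
    frobNorm (Lt⁻¹ * dL) ≤
      (1 - Real.sqrt (1 - 2 * condF Lt * condF (Lt⁻¹ᵀ) * ε)) / Real.sqrt 2 := by
  set c := condF Lt * condF Lt⁻¹ᵀ * ε with hc
  obtain ⟨d, hd, hJ⟩ : ∃ d : Fin (m + n) → ℝ, (∀ i, d i * d i = 1) ∧ Jmat m n = diagonal d :=
    ⟨_, fun i => by split_ifs <;> norm_num, rfl⟩
  rw [hJ] at hfact hfact'
  have hu := hLt.isUnit_det hLtd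
  have hinv : Lt⁻¹ * Lt = 1 := nonsing_inv_mul Lt hu
  have hinvT : Ltᵀ * Lt⁻¹ᵀ = 1 := by rw [← transpose_mul, hinv, transpose_one]
  have hEc := norm_scaled_perturbation_le hε hu hbound
  have hE : (Lt⁻¹ * dK * Lt⁻¹ᵀ)ᵀ = Lt⁻¹ * dK * Lt⁻¹ᵀ := by
    simp only [transpose_mul, transpose_transpose, hdK, Matrix.mul_assoc]
  obtain ⟨X, hX, hXr, hXeq⟩ := exists_small_triangular_solution hd hE hEc hsmall
  have hsub : Lt⁻¹ * (Lt - dL) = 1 - Lt⁻¹ * dL := by rw [Matrix.mul_sub, hinv]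
  have hXlow : IsLowerTri (1 - X) := fun i j hij => by
    rw [Matrix.sub_apply, one_apply_ne hij.ne, hX i j hij, sub_zero]
  have hr1 : (1 - √(1 - 2 * c)) / √2 < 1 := by
    have : (1 : ℝ) < √2 := Real.lt_sqrt_of_sq_lt (by norm_num)
    rw [div_lt_one (by positivity)]
    linarith [Real.sqrt_nonneg (1 - 2 * c)]
  have hXpos : PosDiag (1 - X) := fun i => by
    have := (le_abs_self _).trans ((abs_entry_le_norm X i i).trans hXr)
    rw [Matrix.sub_apply, one_apply_eq]
    linarith
  have hLi := hLt.inv hLtd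
  have hfac : (Lt⁻¹ * (Lt - dL)) * diagonal d * (Lt⁻¹ * (Lt - dL))ᵀ =
      (1 - X) * diagonal d * (1 - X)ᵀ := by
    calc _ = Lt⁻¹ * ((Lt - dL) * diagonal d * (Lt - dL)ᵀ) * Lt⁻¹ᵀ := by
          simp only [transpose_mul, Matrix.mul_assoc]
      _ = Lt⁻¹ * (Lt * diagonal d * Ltᵀ - dK) * Lt⁻¹ᵀ := by
          rw [← hfact', ← hfact, add_sub_cancel_right]
      _ = (Lt⁻¹ * Lt) * diagonal d * (Ltᵀ * Lt⁻¹ᵀ) - Lt⁻¹ * dK * Lt⁻¹ᵀ := by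
          simp only [Matrix.mul_sub, Matrix.sub_mul, Matrix.mul_assoc]
      _ = _ := by rw [hinv, hinvT, Matrix.one_mul, Matrix.mul_one, hXeq]
  have heq := generalizedCholesky_unique hd (hLi.mul hL')
    (hLi.posDiag_mul hL' (hLt.posDiag_inv hLtd) hL'd) hXlow hXpos hfac
  rw [hsub, sub_right_inj] at heq
  rw [heq, frobNorm_eq_norm, mul_assoc 2, mul_assoc 2, ← hc]
  exact hXr
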